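/- arXiv:2211.15249 — 2 statements merged into one kernel-verified Lean document; each statement's English description precedes it below -/
import Mathlib

section
/- Let F be the free group of finite rank d, and let π : F → Γ and π_m : F → Γ_m (m ∈ ℕ) be epimorphisms onto groups Γ, Γ_m such that (a) ker π_m ⊆ ker π for every m (so that for each m there is an epimorphism Γ_m → Γ compatible with the markings), and (b) for every K ∈ ℕ there is N such that for all m ≥ N, ker π_m ∩ B(K) = ker π ∩ B(K), where B(K) is the ball of radius K in F with respect to the free basis (i.e. the marked groups (Γ_m, π_m) converge to (Γ, π) in the space of marked groups). If Γ_m is stable for every m, then Γ is locally stable. -/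
open Filter Topology

open scoped Classical

/-- Normalized Hamming metric on `Sym(k)`:
`d_k(σ,τ) = |{i : σ i ≠ τ i}| / k` (which equals `1 - |{i : σ i = τ i}|/k` for `k ≥ 1`). -/
noncomputable def dHam {k : ℕ} (σ τ : Equiv.Perm (Fin k)) : ℝ :=
  ((Finset.univ.filter fun i => σ i ≠ τ i).card : ℝ) / k

/-- `(φ_n)` is an almost-homomorphism. -/
def IsAlmostHom {Γ : Type*} [Group Γ] (k : ℕ → ℕ)
    (φ : ∀ n, Γ → Equiv.Perm (Fin (k n))) : Prop :=
  ∀ g h : Γ,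
    Tendsto (fun n => dHam (φ n g * φ n h) (φ n (g * h))) atTop (𝓝 0)

/-- `(φ_n)` is a partial homomorphism. -/
def IsPartialHom {Γ : Type*} [Group Γ] (k : ℕ → ℕ)
    (φ : ∀ n, Γ → Equiv.Perm (Fin (k n))) : Prop :=
  ∀ g h : Γ, ∀ᶠ n in atTop, φ n (g * h) = φ n g * φ n h

/-- `(φ_n)` is separating. -/
def IsSeparating {Γ : Type*} [Group Γ] (k : ℕ → ℕ)
    (φ : ∀ n, Γ → Equiv.Perm (Fin (k n))) : Prop :=
  ∀ g : Γ, g ≠ 1 → Tendsto (fun n => dHam (φ n g) 1) atTop (𝓝 1)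

/-- `(φ_n)` is a sequence of genuine homomorphisms. -/
def IsHomSeq {Γ : Type*} [Group Γ] (k : ℕ → ℕ)
    (φ : ∀ n, Γ → Equiv.Perm (Fin (k n))) : Prop :=
  ∀ n, ∀ g h : Γ, φ n (g * h) = φ n g * φ n h

/-- `(ψ_n)` is asymptotically close to `(φ_n)`: for every `g`, `d_{k_n}(φ_n g, ψ_n g) → 0`. -/
def CloseSeq {Γ : Type*} [Group Γ] (k : ℕ → ℕ)
    (φ ψ : ∀ n, Γ → Equiv.Perm (Fin (k n))) : Prop :=
  ∀ g : Γ, Tendsto (fun n => dHam (φ n g) (ψ n g)) atTop (𝓝 0)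

/-- `Γ` is locally stable. -/
def IsLocallyStable (Γ : Type*) [Group Γ] : Prop :=
  ∀ (k : ℕ → ℕ), (∀ n, 0 < k n) →
    ∀ φ : ∀ n, Γ → Equiv.Perm (Fin (k n)), IsAlmostHom k φ →
      ∃ ψ : ∀ n, Γ → Equiv.Perm (Fin (k n)), IsPartialHom k ψ ∧ CloseSeq k φ ψ

/-- `Γ` is weakly locally stable. -/
def IsWeaklyLocallyStable (Γ : Type*) [Group Γ] : Prop :=
  ∀ (k : ℕ → ℕ), (∀ n, 0 < k n) →
    ∀ φ : ∀ n, Γ → Equiv.Perm (Fin (k n)), IsAlmostHom k φ → IsSeparating k φ →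
      ∃ ψ : ∀ n, Γ → Equiv.Perm (Fin (k n)), IsPartialHom k ψ ∧ CloseSeq k φ ψ

/-- `Γ` is stable (in permutations). -/
def IsStable (Γ : Type*) [Group Γ] : Prop :=
  ∀ (k : ℕ → ℕ), (∀ n, 0 < k n) →
    ∀ φ : ∀ n, Γ → Equiv.Perm (Fin (k n)), IsAlmostHom k φ →
      ∃ ψ : ∀ n, Γ → Equiv.Perm (Fin (k n)), IsHomSeq k ψ ∧ CloseSeq k φ ψ

/-- `Γ` is weakly stable. -/
def IsWeaklyStable (Γ : Type*) [Group Γ] : Prop :=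
  ∀ (k : ℕ → ℕ), (∀ n, 0 < k n) →
    ∀ φ : ∀ n, Γ → Equiv.Perm (Fin (k n)), IsAlmostHom k φ → IsSeparating k φ →
      ∃ ψ : ∀ n, Γ → Equiv.Perm (Fin (k n)), IsHomSeq k ψ ∧ CloseSeq k φ ψ

/-- `Γ` is sofic: it admits a separating almost-homomorphism. -/
def IsSofic (Γ : Type*) [Group Γ] : Prop :=
  ∃ (k : ℕ → ℕ), (∀ n, 0 < k n) ∧
    ∃ φ : ∀ n, Γ → Equiv.Perm (Fin (k n)), IsAlmostHom k φ ∧ IsSeparating k φ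

/-- `Γ` is LEF: it admits a separating partial homomorphism. -/
def IsLEF (Γ : Type*) [Group Γ] : Prop :=
  ∃ (k : ℕ → ℕ), (∀ n, 0 < k n) ∧
    ∃ φ : ∀ n, Γ → Equiv.Perm (Fin (k n)), IsPartialHom k φ ∧ IsSeparating k φ

/-- Diagonal argument: if each `P m` holds eventually, then `P (u n) n` holds eventually for some
sequence `u` tending to infinity. -/
theorem exists_tendsto_atTop_eventually_diagonal {P : ℕ → ℕ → Prop}
    (h : ∀ m, ∀ᶠ n in atTop, P m n) :
    ∃ u : ℕ → ℕ, Tendsto u atTop atTop ∧ ∀ᶠ n in atTop, P (u n) n := by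
  refine ⟨fun n => Nat.findGreatest (fun m => P m n) n, ?_, ?_⟩
  · refine tendsto_atTop.2 fun m => ?_
    filter_upwards [h m, eventually_ge_atTop m] with n hn hmn
    exact Nat.le_findGreatest hmn hn
  · filter_upwards [h 0] with n hn
    exact Nat.findGreatest_spec (P := fun m => P m n) (Nat.zero_le n) hn

/-- A countable family of double sequences whose rows tend to zero tends to zero along a common
diagonal. -/
theorem exists_tendsto_atTop_diagonal_tendsto_zero {ι : Type*} [Countable ι]
    {a : ι → ℕ → ℕ → ℝ} (ha : ∀ i m n, 0 ≤ a i m n)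
    (h : ∀ i m, Tendsto (a i m) atTop (𝓝 0)) :
    ∃ u : ℕ → ℕ, Tendsto u atTop atTop ∧ ∀ i, Tendsto (fun n => a i (u n) n) atTop (𝓝 0) := by
  obtain ⟨e, he⟩ := exists_injective_nat ι
  have hfin (m : ℕ) : {i | e i ≤ m}.Finite := (Set.finite_Iic m).preimage he.injOn
  obtain ⟨u, hu, hP⟩ := exists_tendsto_atTop_eventually_diagonal
    (P := fun m n => ∀ i ∈ {i | e i ≤ m}, a i m n < 1 / ((m : ℝ) + 1)) fun m =>
      (eventually_all_finite (hfin m)).2 fun i _ => (h i m).eventually_lt_const (by positivity)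
  refine ⟨u, hu, fun i => ?_⟩
  refine tendsto_of_tendsto_of_tendsto_of_le_of_le' tendsto_const_nhds
    (tendsto_one_div_add_atTop_nhds_zero_nat.comp hu) (Eventually.of_forall fun n => ha i _ n) ?_
  filter_upwards [hP, hu.eventually_ge_atTop (e i)] with n hn hi
  exact (hn i hi).le

theorem dHam_nonneg {k : ℕ} (σ τ : Equiv.Perm (Fin k)) : 0 ≤ dHam σ τ := by
  unfold dHam
  positivity

theorem IsAlmostHom.comp {Γ Δ : Type*} [Group Γ] [Group Δ] {k : ℕ → ℕ}
    {φ : ∀ n, Γ → Equiv.Perm (Fin (k n))} (hφ : IsAlmostHom k φ) (f : Δ →* Γ) :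
    IsAlmostHom k fun n x => φ n (f x) := fun x y => by
  simpa only [map_mul] using hφ (f x) (f y)

/-- If marked groups `(Γ_m, π_m)` converge to `(Γ, π)` in the space of marked groups, in
such a way that each `Γ_m` admits a compatible marked epimorphism onto `Γ`
(i.e. `ker π_m ⊆ ker π`), and every `Γ_m` is stable, then `Γ` is locally stable. -/
theorem locallyStable_of_markedLimit_of_stable (d : ℕ) (Γ : Type) [Group Γ]
    (Γm : ℕ → Type) [∀ m, Group (Γm m)]
    (π : FreeGroup (Fin d) →* Γ) (hπ : Function.Surjective π)
    (πm : ∀ m, FreeGroup (Fin d) →* Γm m) (hπm : ∀ m, Function.Surjective (πm m))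
    (hker : ∀ m, (πm m).ker ≤ π.ker)
    (hconv : ∀ K : ℕ, ∃ N : ℕ, ∀ m ≥ N, ∀ w : FreeGroup (Fin d),
      w.toWord.length ≤ K → (w ∈ (πm m).ker ↔ w ∈ π.ker))
    (hstable : ∀ m, IsStable (Γm m)) :
    IsLocallyStable Γ := by
  intro k hk φ hφ
  let p (m : ℕ) : Γm m →* Γ := (πm m).liftOfSurjective (hπm m) ⟨π, hker m⟩
  have hp (m : ℕ) (w : FreeGroup (Fin d)) : p m (πm m w) = π w :=
    (πm m).liftOfRightInverse_comp_apply _ _ ⟨π, hker m⟩ w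
  choose ψ hψ hclose using fun m => hstable m k hk _ (hφ.comp (p m))
  choose s hs using hπ
  have : Countable (FreeGroup (Fin d)) := FreeGroup.toWord_injective.countable
  have : Countable Γ := (Function.LeftInverse.injective hs).countable
  obtain ⟨u, hu, hlim⟩ := exists_tendsto_atTop_diagonal_tendsto_zero
    (a := fun g m n => dHam (φ n g) (ψ m n (πm m (s g))))
    (fun _ _ _ => dHam_nonneg _ _)
    (fun g m => by simpa only [hp, hs] using hclose m (πm m (s g)))
  refine ⟨fun n g => ψ (u n) n (πm (u n) (s g)), fun g h => ?_, hlim⟩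
  obtain ⟨N, hN⟩ := hconv ((s (g * h))⁻¹ * (s g * s h)).toWord.length
  filter_upwards [hu.eventually_ge_atTop N] with n hn
  have hmem : (s (g * h))⁻¹ * (s g * s h) ∈ (πm (u n)).ker :=
    (hN _ hn _ le_rfl).2 (by simp [MonoidHom.mem_ker, hs])
  rw [MonoidHom.mem_ker, map_mul, map_inv, inv_mul_eq_one, map_mul] at hmem
  rw [hmem, hψ]
end

section
/- Let F be the free group on two generators x₁, x₂, and π : F → Sym(ℤ) the homomorphism with π(x₁) = t (translation n ↦ n + 1) and π(x₂) = c = (−1 0 1), whose image is 𝒜(ℤ). Fix a strictly increasing function r₀ : ℕ → ℕ with r₀(m) ≥ 2 for all m. For r ≥ 2 let ⟦r⟧ = {m ∈ ℤ : |m| ≤ r}, α_r ∈ Sym(⟦r⟧) the (2r+1)-cycle (−r, 1−r, …, r−1, r), β_r = (−1 0 1) ∈ Sym(⟦r⟧), and π_r : F → Sym(⟦r⟧) the homomorphism sending x₁ ↦ α_r, x₂ ↦ β_r. For each n let π̃_n : F → Π_m Sym(⟦r₀(m+n)⟧) be the homomorphism whose m-th coordinate is π_{r₀(m+n)} (its image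 is the diagonal product G(r_n) of the marked alternating groups). Then for every K ∈ ℕ there is N such that for all n ≥ N and every word w ∈ F of length at most K: π(w) = id if and only if π̃_n(w) = id. (That is, the marked diagonal products (G(r_n), π̃_n) converge to (𝒜(ℤ), (t, c)) in the space of marked 2-generated groups.) -/
/-- The translation `n ↦ n + 1` as a permutation of `ℤ`. -/
def translation : Equiv.Perm ℤ := Equiv.addRight 1

/-- The 3-cycle `(a b c)` (sending `a ↦ b ↦ c ↦ a`) as a permutation of `ℤ`. -/
def threeCycle (a b c : ℤ) : Equiv.Perm ℤ := Equiv.swap a c * Equiv.swap a b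

/-- The interval `⟦r⟧ = {m ∈ ℤ : |m| ≤ r}`. -/
abbrev IntBall (r : ℕ) : Type := {m : ℤ // |m| ≤ (r : ℤ)}

private def bcFun (r : ℕ) (x : IntBall r) : IntBall r :=
  if h : (x : ℤ) < (r : ℤ) then
    ⟨(x : ℤ) + 1, by have hx := abs_le.mp x.2; rw [abs_le]; omega⟩
  else ⟨-(r : ℤ), by rw [abs_le]; omega⟩

private def bcInv (r : ℕ) (x : IntBall r) : IntBall r :=
  if h : -(r : ℤ) < (x : ℤ) then
    ⟨(x : ℤ) - 1, by have hx := abs_le.mp x.2; rw [abs_le]; omega⟩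
  else ⟨(r : ℤ), by rw [abs_le]; omega⟩

private lemma bc_left (r : ℕ) : Function.LeftInverse (bcInv r) (bcFun r) := by
  rintro ⟨x, hx⟩
  have hx' := abs_le.mp hx
  simp only [bcFun, bcInv]
  split_ifs with h1 h2 h2 <;>
    (apply Subtype.ext;
      simp only [Subtype.coe_mk] at h2 ⊢; omega)

private lemma bc_right (r : ℕ) : Function.RightInverse (bcInv r) (bcFun r) := by
  rintro ⟨x, hx⟩
  have hx' := abs_le.mp hx
  simp only [bcFun, bcInv]
  split_ifs with h1 h2 h2 <;>
    (apply Subtype.ext;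
      simp only [Subtype.coe_mk] at h2 ⊢; omega)

/-- The `(2r+1)`-cycle `α_r = (-r, 1-r, …, r-1, r)` on `⟦r⟧`. -/
def bigCycle (r : ℕ) : Equiv.Perm (IntBall r) :=
  ⟨bcFun r, bcInv r, bc_left r, bc_right r⟩

/-- The 3-cycle `β_r = (-1 0 1)` on `⟦r⟧` (for `r ≥ 2`). -/
def smallCycle (r : ℕ) (hr : 2 ≤ r) : Equiv.Perm (IntBall r) :=
  Equiv.swap ⟨-1, by rw [abs_le]; omega⟩ ⟨1, by rw [abs_le]; omega⟩ *
    Equiv.swap ⟨-1, by rw [abs_le]; omega⟩ ⟨0, by rw [abs_le]; omega⟩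

/-- The marked homomorphism `π_r : F₂ → Sym(⟦r⟧)`, `x₁ ↦ α_r`, `x₂ ↦ β_r`. -/
def ballHom (r : ℕ) (hr : 2 ≤ r) : FreeGroup (Fin 2) →* Equiv.Perm (IntBall r) :=
  FreeGroup.lift ![bigCycle r, smallCycle r hr]

/-- The marked homomorphism `π : F₂ → Sym(ℤ)`, `x₁ ↦ t`, `x₂ ↦ c = (-1 0 1)`;
its image is the alternating enrichment `𝒜(ℤ)`. -/
def enrichHom : FreeGroup (Fin 2) →* Equiv.Perm ℤ :=
  FreeGroup.lift ![translation, threeCycle (-1) 0 1]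

/-- The homomorphism `π̃_n : F₂ → Π_m Sym(⟦r₀(m+n)⟧)` whose `m`-th coordinate is
`π_{r₀(m+n)}`; its image is the diagonal product `G(r_n)` of the marked alternating
groups `(Alt(⟦r₀(m+n)⟧), (α, β))`. -/
def diagHom (r₀ : ℕ → ℕ) (hr₀ : ∀ m, 2 ≤ r₀ m) (n : ℕ) :
    FreeGroup (Fin 2) →* (∀ m : ℕ, Equiv.Perm (IntBall (r₀ (m + n)))) :=
  FreeGroup.lift fun i => fun m =>
    ![bigCycle (r₀ (m + n)), smallCycle (r₀ (m + n)) (hr₀ (m + n))] i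

lemma coe_bigCycle_apply (r : ℕ) (y : IntBall r) :
    (bigCycle r y : ℤ) = if (y : ℤ) < r then (y : ℤ) + 1 else -(r : ℤ) := by
  change ((bcFun r y : IntBall r) : ℤ) = _
  unfold bcFun
  split_ifs <;> rfl

lemma coe_bigCycle_inv_apply (r : ℕ) (y : IntBall r) :
    (((bigCycle r)⁻¹ y : IntBall r) : ℤ) = if -(r : ℤ) < y then (y : ℤ) - 1 else (r : ℤ) := by
  change ((bcInv r y : IntBall r) : ℤ) = _
  unfold bcInv
  split_ifs <;> rfl

lemma threeCycle_apply (x : ℤ) :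
    threeCycle (-1) 0 1 x = if x = -1 then 0 else if x = 0 then 1 else if x = 1 then -1 else x := by
  simp only [threeCycle, Equiv.Perm.mul_apply, Equiv.swap_apply_def]
  by_cases h1 : x = -1 <;> by_cases h2 : x = 0 <;> by_cases h3 : x = 1 <;> simp_all

lemma threeCycle_inv_apply (x : ℤ) :
    (threeCycle (-1) 0 1)⁻¹ x =
      if x = -1 then 1 else if x = 0 then -1 else if x = 1 then 0 else x := by
  rw [Equiv.Perm.inv_eq_iff_eq, threeCycle_apply]
  by_cases h1 : x = -1 <;> by_cases h2 : x = 0 <;> by_cases h3 : x = 1 <;> simp_all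

lemma coe_smallCycle_apply (r : ℕ) (hr : 2 ≤ r) (y : IntBall r) :
    (smallCycle r hr y : ℤ) = threeCycle (-1) 0 1 y := by
  simp only [smallCycle, threeCycle, Equiv.Perm.mul_apply, Equiv.swap_apply_def, Subtype.ext_iff]
  split_ifs <;> simp_all

lemma coe_smallCycle_inv_apply (r : ℕ) (hr : 2 ≤ r) (y : IntBall r) :
    (((smallCycle r hr)⁻¹ y : IntBall r) : ℤ) = (threeCycle (-1) 0 1)⁻¹ y := by
  rw [Equiv.Perm.eq_inv_iff_eq, ← coe_smallCycle_apply r hr]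
  exact congrArg Subtype.val ((smallCycle r hr).apply_symm_apply y)

/-- The permutation of `ℤ` given by a signed letter. -/
def enrichLetter (a : Fin 2 × Bool) : Equiv.Perm ℤ :=
  enrichHom (FreeGroup.mk [a])

/-- The permutation of `⟦r⟧` given by a signed letter. -/
def ballLetter (r : ℕ) (hr : 2 ≤ r) (a : Fin 2 × Bool) : Equiv.Perm (IntBall r) :=
  ballHom r hr (FreeGroup.mk [a])

lemma enrichHom_mk_cons (a : Fin 2 × Bool) (L : List (Fin 2 × Bool)) (x : ℤ) :
    enrichHom (FreeGroup.mk (a :: L)) x = enrichLetter a (enrichHom (FreeGroup.mk L) x) := by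
  rw [enrichLetter, ← Equiv.Perm.mul_apply, ← map_mul, FreeGroup.mul_mk, List.singleton_append]

lemma ballHom_mk_cons (r : ℕ) (hr : 2 ≤ r) (a : Fin 2 × Bool) (L : List (Fin 2 × Bool))
    (y : IntBall r) :
    ballHom r hr (FreeGroup.mk (a :: L)) y =
      ballLetter r hr a (ballHom r hr (FreeGroup.mk L) y) := by
  rw [ballLetter, ← Equiv.Perm.mul_apply, ← map_mul, FreeGroup.mul_mk, List.singleton_append]

lemma enrichLetter_zero_true (x : ℤ) : enrichLetter (0, true) x = x + 1 := by
  simp [enrichLetter, enrichHom, translation]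

lemma enrichLetter_zero_false (x : ℤ) : enrichLetter (0, false) x = x - 1 := by
  simp [enrichLetter, enrichHom, translation, sub_eq_add_neg]

lemma enrichLetter_one_true : enrichLetter (1, true) = threeCycle (-1) 0 1 := by
  simp [enrichLetter, enrichHom]

lemma enrichLetter_one_false : enrichLetter (1, false) = (threeCycle (-1) 0 1)⁻¹ := by
  simp [enrichLetter, enrichHom]

lemma ballLetter_zero_true (r : ℕ) (hr : 2 ≤ r) : ballLetter r hr (0, true) = bigCycle r := by
  simp [ballLetter, ballHom]

lemma ballLetter_zero_false (r : ℕ) (hr : 2 ≤ r) :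
    ballLetter r hr (0, false) = (bigCycle r)⁻¹ := by
  simp [ballLetter, ballHom]

lemma ballLetter_one_true (r : ℕ) (hr : 2 ≤ r) :
    ballLetter r hr (1, true) = smallCycle r hr := by
  simp [ballLetter, ballHom]

lemma ballLetter_one_false (r : ℕ) (hr : 2 ≤ r) :
    ballLetter r hr (1, false) = (smallCycle r hr)⁻¹ := by
  simp [ballLetter, ballHom]

/-- Away from `{-1, 0, 1}` a letter acts on `ℤ` as a translation. -/
lemma exists_enrichLetter_eq_add (a : Fin 2 × Bool) :
    ∃ e : ℤ, |e| ≤ 1 ∧ ∀ x : ℤ, 1 < |x| → enrichLetter a x = x + e := by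
  obtain ⟨i, b⟩ := a
  fin_cases i <;> cases b
  · exact ⟨-1, by simp, fun x _ => enrichLetter_zero_false x⟩
  · exact ⟨1, by simp, fun x _ => enrichLetter_zero_true x⟩
  · refine ⟨0, by simp, fun x hx => ?_⟩
    rw [lt_abs] at hx
    rw [Fin.mk_one, enrichLetter_one_false, threeCycle_inv_apply]
    split_ifs <;> omega
  · refine ⟨0, by simp, fun x hx => ?_⟩
    rw [lt_abs] at hx
    rw [Fin.mk_one, enrichLetter_one_true, threeCycle_apply]
    split_ifs <;> omega

lemma abs_enrichLetter_sub_le (a : Fin 2 × Bool) (x : ℤ) : |enrichLetter a x - x| ≤ 2 := by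
  obtain ⟨i, b⟩ := a
  rw [abs_le]
  fin_cases i <;> cases b
  · rw [Fin.zero_eta, enrichLetter_zero_false]
    omega
  · rw [Fin.zero_eta, enrichLetter_zero_true]
    omega
  · rw [Fin.mk_one, enrichLetter_one_false, threeCycle_inv_apply]
    split_ifs <;> omega
  · rw [Fin.mk_one, enrichLetter_one_true, threeCycle_apply]
    split_ifs <;> omega

lemma modEq_ballLetter (r : ℕ) (hr : 2 ≤ r) (a : Fin 2 × Bool) (y : IntBall r) (x : ℤ)
    (hx : |x| ≤ 2 * r - 1) (h : (y : ℤ) ≡ x [ZMOD 2 * r + 1]) :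
    (ballLetter r hr a y : ℤ) ≡ enrichLetter a x [ZMOD 2 * r + 1] := by
  have hy := abs_le.mp y.2
  rw [abs_le] at hx
  have key : x = y ∨ x = y + (2 * r + 1) ∨ x = y - (2 * r + 1) := by
    obtain ⟨k, hk⟩ := h.dvd
    have h1 : k < 2 := by nlinarith
    have h2 : -2 < k := by nlinarith
    interval_cases k <;> omega
  have of_cases : ∀ u v : ℤ, v = u ∨ v = u + (2 * r + 1) ∨ v = u - (2 * r + 1) ∨
      v = u + 2 * (2 * r + 1) ∨ v = u - 2 * (2 * r + 1) → u ≡ v [ZMOD 2 * r + 1] := by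
    intro u v huv
    rw [Int.modEq_iff_dvd]
    rcases huv with rfl | rfl | rfl | rfl | rfl
    · exact ⟨0, by ring⟩
    · exact ⟨1, by ring⟩
    · exact ⟨-1, by ring⟩
    · exact ⟨2, by ring⟩
    · exact ⟨-2, by ring⟩
  apply of_cases
  obtain ⟨i, b⟩ := a
  fin_cases i <;> cases b
  · rw [Fin.zero_eta, ballLetter_zero_false, enrichLetter_zero_false, coe_bigCycle_inv_apply]
    split_ifs <;> omega
  · rw [Fin.zero_eta, ballLetter_zero_true, enrichLetter_zero_true, coe_bigCycle_apply]
    split_ifs <;> omega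
  · rw [Fin.mk_one, ballLetter_one_false, enrichLetter_one_false, coe_smallCycle_inv_apply,
      threeCycle_inv_apply, threeCycle_inv_apply]
    split_ifs <;> omega
  · rw [Fin.mk_one, ballLetter_one_true, enrichLetter_one_true, coe_smallCycle_apply,
      threeCycle_apply, threeCycle_apply]
    split_ifs <;> omega

lemma exists_enrichHom_mk_eq_add (L : List (Fin 2 × Bool)) :
    ∃ e : ℤ, |e| ≤ L.length ∧
      ∀ x : ℤ, L.length + 1 < |x| → enrichHom (FreeGroup.mk L) x = x + e := by
  induction L with
  | nil => exact ⟨0, by simp, fun x _ => by simp [enrichHom]⟩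
  | cons a L ih =>
    obtain ⟨e, he, h⟩ := ih
    obtain ⟨d, hd, h'⟩ := exists_enrichLetter_eq_add a
    refine ⟨e + d, ?_, fun x hx => ?_⟩
    · have := abs_add_le e d
      push_cast [List.length_cons]
      linarith
    · push_cast [List.length_cons] at hx
      have hxe : |x| ≤ |x + e| + |e| := by simpa using abs_sub (x + e) e
      rw [enrichHom_mk_cons, h x (by linarith), h' _ (by linarith), add_assoc]

lemma abs_enrichHom_mk_sub_le (L : List (Fin 2 × Bool)) (x : ℤ) :
    |enrichHom (FreeGroup.mk L) x - x| ≤ 2 * L.length := by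
  induction L with
  | nil => simp [enrichHom]
  | cons a L ih =>
    have h := abs_enrichLetter_sub_le a (enrichHom (FreeGroup.mk L) x)
    rw [enrichHom_mk_cons]
    have := abs_sub_le (enrichLetter a (enrichHom (FreeGroup.mk L) x))
      (enrichHom (FreeGroup.mk L) x) x
    push_cast [List.length_cons]
    linarith

lemma modEq_ballHom_mk (r : ℕ) (hr : 2 ≤ r) (L : List (Fin 2 × Bool))
    (hL : 2 * L.length + 1 ≤ r) (y : IntBall r) :
    (ballHom r hr (FreeGroup.mk L) y : ℤ) ≡ enrichHom (FreeGroup.mk L) y [ZMOD 2 * r + 1] := by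
  induction L with
  | nil =>
    rw [← FreeGroup.one_eq_mk, map_one, map_one]
    rfl
  | cons a L ih =>
    rw [List.length_cons] at hL
    rw [enrichHom_mk_cons, ballHom_mk_cons]
    refine modEq_ballLetter r hr a _ _ ?_ (ih (by omega))
    have h1 := abs_le.mp (abs_enrichHom_mk_sub_le L y)
    have h2 := abs_le.mp y.2
    rw [abs_le]
    omega

/-- On short words the marked group on `⟦r⟧` and the one on `ℤ` satisfy the same relations. -/
theorem enrichHom_eq_one_iff_ballHom_eq_one (r : ℕ) (hr : 2 ≤ r) (w : FreeGroup (Fin 2))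
    (hw : 2 * w.toWord.length + 2 ≤ r) : enrichHom w = 1 ↔ ballHom r hr w = 1 := by
  rw [← FreeGroup.mk_toWord (x := w)]
  generalize w.toWord = L at hw ⊢
  have hmod := modEq_ballHom_mk r hr L (by omega)
  constructor
  · intro h
    ext y
    have hy := (hmod y).dvd
    rw [h, Equiv.Perm.one_apply] at hy
    have h1 := abs_le.mp y.2
    have h2 := abs_le.mp (ballHom r hr (FreeGroup.mk L) y).2
    have := Int.eq_zero_of_abs_lt_dvd hy (by rw [abs_lt]; omega)
    rw [Equiv.Perm.one_apply]
    omega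
  · intro h
    have hball : ∀ x : ℤ, |x| ≤ r → enrichHom (FreeGroup.mk L) x = x := by
      intro x hx
      have hd := (hmod ⟨x, hx⟩).dvd
      rw [h, Equiv.Perm.one_apply] at hd
      have h1 := abs_le.mp (abs_enrichHom_mk_sub_le L x)
      have := Int.eq_zero_of_abs_lt_dvd hd (by rw [abs_lt]; dsimp only; omega)
      dsimp only at this
      omega
    obtain ⟨e, -, he⟩ := exists_enrichHom_mk_eq_add L
    have hr_abs : |(r : ℤ)| = r := abs_of_nonneg (by omega)
    have he0 : e = 0 := by
      have h1 := he r (by omega)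
      rw [hball r hr_abs.le] at h1
      omega
    ext x
    rw [Equiv.Perm.one_apply]
    by_cases hx : |x| ≤ r
    · exact hball x hx
    · rw [he x (by omega), he0, add_zero]

lemma diagHom_apply (r₀ : ℕ → ℕ) (hr₀ : ∀ m, 2 ≤ r₀ m) (n : ℕ) (w : FreeGroup (Fin 2)) (m : ℕ) :
    diagHom r₀ hr₀ n w m = ballHom (r₀ (m + n)) (hr₀ (m + n)) w := by
  have : (Pi.evalMonoidHom _ m).comp (diagHom r₀ hr₀ n) =
      ballHom (r₀ (m + n)) (hr₀ (m + n)) := by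
    ext1 i
    simp [diagHom, ballHom]
  exact DFunLike.congr_fun this w

/-- The marked diagonal products `(G(r_n), π̃_n)` converge to `(𝒜(ℤ), (t, c))` in the
space of marked 2-generated groups. -/
theorem marked_diagonal_products_converge (r₀ : ℕ → ℕ) (hmono : StrictMono r₀)
    (hr₀ : ∀ m, 2 ≤ r₀ m) (K : ℕ) :
    ∃ N : ℕ, ∀ n ≥ N, ∀ w : FreeGroup (Fin 2), w.toWord.length ≤ K →
      (enrichHom w = 1 ↔ diagHom r₀ hr₀ n w = 1) := by
  refine ⟨2 * K + 2, fun n hn w hw => ?_⟩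
  have key (m : ℕ) : enrichHom w = 1 ↔ ballHom (r₀ (m + n)) (hr₀ (m + n)) w = 1 := by
    have := hmono.le_apply (x := m + n)
    exact enrichHom_eq_one_iff_ballHom_eq_one _ _ w (by omega)
  constructor
  · intro h
    funext m
    rw [diagHom_apply]
    exact (key m).mp h
  · intro h
    apply (key 0).mpr
    rw [← diagHom_apply, h]
    rfl
end
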